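/- Let n be a positive integer with n ≡ 1 (mod 4) and M = (n-1)/2 or n-1. Then, for indeterminates a and b, the identity Σ_{k=0}^{M} [6k+1]·(q,q^{1−n},q^{1+n};q²)_k·(q/b;q⁴)_k / ((q⁴,q^{4+n},q^{4−n};q⁴)_k·(bq²;q²)_k)·q^{k²+k}·b^k = ((q⁵,q²/b;q⁴)_{(n-1)/4} / ((q,bq⁴;q⁴)_{(n-1)/4}))·(b/q)^{(n-1)/4} holds as rational functions of b and q. -/

import Mathlib

/-- The q-shifted factorial `(x;q)_k = (1-x)(1-xq)⋯(1-xq^{k-1})`. -/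
def qPoch {K : Type*} [Field K] (x q : K) (k : ℕ) : K :=
  ∏ i ∈ Finset.range k, (1 - x * q ^ i)

/-- The q-integer `[r] = 1 + q + ⋯ + q^{r-1}`. -/
def qint {K : Type*} [Field K] (q : K) (r : ℕ) : K :=
  ∑ i ∈ Finset.range r, q ^ i

/-- The field ℚ(q,b) of rational functions in two indeterminates over ℚ. -/
abbrev Qqb : Type := FractionRing (MvPolynomial (Fin 2) ℚ)

/-- The indeterminate `q` of ℚ(q,b). -/
noncomputable def qv : Qqb := algebraMap (MvPolynomial (Fin 2) ℚ) Qqb (MvPolynomial.X 0)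

/-- The indeterminate `b` of ℚ(q,b). -/
noncomputable def bv : Qqb := algebraMap (MvPolynomial (Fin 2) ℚ) Qqb (MvPolynomial.X 1)

section QPoch

variable {K : Type*} [Field K]

theorem qPoch_succ (x q : K) (k : ℕ) : qPoch x q (k + 1) = qPoch x q k * (1 - x * q ^ k) :=
  Finset.prod_range_succ _ _

theorem one_sub_mul_qPoch_mul (x q : K) (k : ℕ) :
    (1 - x) * qPoch (x * q) q k = qPoch x q k * (1 - x * q ^ k) := by
  rw [← qPoch_succ, qPoch, qPoch, Finset.prod_range_succ', mul_comm]
  simp [pow_succ', mul_assoc]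

theorem qPoch_eq_zero {x q : K} {i k : ℕ} (hik : i < k) (h : x * q ^ i = 1) :
    qPoch x q k = 0 :=
  Finset.prod_eq_zero (Finset.mem_range.2 hik) (by rw [h, sub_self])

theorem qint_eq {q : K} (hq : q ≠ 1) (r : ℕ) : qint q r = (1 - q ^ r) / (1 - q) := by
  rw [qint, geom_sum_eq hq, ← neg_sub, ← neg_sub (1 : K) q, neg_div_neg_eq]

/-- The summand of the quadratic summation, with `c` in the role of `q ^ n`. -/
def quadTerm (q b c : K) (k : ℕ) : K :=
  qint q (6 * k + 1) *
    (qPoch q (q ^ 2) k * qPoch (q / c) (q ^ 2) k * qPoch (q * c) (q ^ 2) k) *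
    qPoch (q / b) (q ^ 4) k /
    ((qPoch (q ^ 4) (q ^ 4) k * qPoch (q ^ 4 * c) (q ^ 4) k * qPoch (q ^ 4 / c) (q ^ 4) k) *
      qPoch (b * q ^ 2) (q ^ 2) k) *
    q ^ (k ^ 2 + k) * b ^ k

/-- The common factor of `quadTerm q b c k` and `quadTerm q b (c * q ^ 4) k`. -/
def quadKernel (q b c : K) (k : ℕ) : K :=
  (qPoch q (q ^ 2) k * qPoch (q / (c * q ^ 4)) (q ^ 2) k * qPoch (q * c) (q ^ 2) k) *
    qPoch (q / b) (q ^ 4) k /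
    ((qPoch (q ^ 4) (q ^ 4) k * qPoch (q ^ 4 * c) (q ^ 4) k * qPoch (q ^ 4 / c) (q ^ 4) k) *
      qPoch (b * q ^ 2) (q ^ 2) k) *
    q ^ (k ^ 2 + k) * b ^ k

/-- The ratio of the closed forms at `c * q ^ 4` and at `c`. -/
def quadRatio (q b c : K) : K :=
  (1 - q ^ 4 * c) * (b - q * c) / ((1 - c) * (1 - b * q ^ 3 * c) * q)

/-- The Wilf–Zeilberger companion of `quadTerm`. -/
def quadCert (q b c : K) (k : ℕ) : K :=
  (1 - q ^ 4 * c) * (1 - q ^ 4 * c ^ 2) * c /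
      ((1 - c) * (1 - b * q ^ 3 * c) * (1 - q) * (1 - q ^ 3 * c) * (1 - q * c)) *
    ((1 - (q ^ (2 * k)) ^ 2) * (1 - (q ^ (2 * k)) ^ 2 / c) * (1 - b * q ^ (2 * k))) *
    quadKernel q b c k

theorem quadKernel_succ (q b c : K) (k : ℕ) :
    quadKernel q b c (k + 1) = quadKernel q b c k *
      ((1 - q * q ^ (2 * k)) * (1 - q / (c * q ^ 4) * q ^ (2 * k)) *
        (1 - q * c * q ^ (2 * k)) * (1 - q / b * (q ^ (2 * k)) ^ 2) /
      ((1 - q ^ 4 * (q ^ (2 * k)) ^ 2) * (1 - q ^ 4 * c * (q ^ (2 * k)) ^ 2) *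
        (1 - q ^ 4 / c * (q ^ (2 * k)) ^ 2) * (1 - b * q ^ 2 * q ^ (2 * k))) *
      (q ^ 2 * q ^ (2 * k)) * b) := by
  have h2 : (q ^ 2) ^ k = q ^ (2 * k) := (pow_mul q 2 k).symm
  have h4 : (q ^ 4) ^ k = (q ^ (2 * k)) ^ 2 := by ring
  have he : q ^ ((k + 1) ^ 2 + (k + 1)) = q ^ (k ^ 2 + k) * (q ^ 2 * q ^ (2 * k)) := by ring
  simp only [quadKernel, qPoch_succ, h2, h4, he, pow_succ b k]
  simp only [div_eq_mul_inv, mul_inv]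
  ring

theorem quadTerm_eq {q b c : K} (hq0 : q ≠ 0) (hc0 : c ≠ 0) (hq : q ≠ 1)
    (hc : ∀ j, c * q ^ j ≠ 1) (k : ℕ) :
    quadTerm q b c k = quadKernel q b c k *
      ((1 - q * (q ^ (2 * k)) ^ 3) / (1 - q) *
        ((1 - q / (c * q ^ 4) * q ^ (2 * k)) * (1 - q / (c * q ^ 4) * q ^ 2 * q ^ (2 * k))) /
        ((1 - q / (c * q ^ 4)) * (1 - q / (c * q ^ 4) * q ^ 2))) := by
  have h2 : (q ^ 2) ^ k = q ^ (2 * k) := (pow_mul q 2 k).symm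
  have h6 : q ^ (6 * k + 1) = q * (q ^ (2 * k)) ^ 3 := by ring
  have e1 := one_sub_mul_qPoch_mul (q / (c * q ^ 4)) (q ^ 2) k
  have e2 := one_sub_mul_qPoch_mul (q / (c * q ^ 4) * q ^ 2) (q ^ 2) k
  have hs : q / (c * q ^ 4) * q ^ 2 * q ^ 2 = q / c := by field_simp
  rw [h2] at e1 e2
  rw [hs] at e2
  have n1 : 1 - q / (c * q ^ 4) ≠ 0 := by
    intro h
    apply hc 3
    field_simp at h
    linear_combination h
  have n2 : 1 - q / (c * q ^ 4) * q ^ 2 ≠ 0 := by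
    intro h
    apply hc 1
    field_simp at h
    linear_combination h
  have e : qPoch (q / c) (q ^ 2) k = qPoch (q / (c * q ^ 4)) (q ^ 2) k *
      (((1 - q / (c * q ^ 4) * q ^ (2 * k)) * (1 - q / (c * q ^ 4) * q ^ 2 * q ^ (2 * k))) /
        ((1 - q / (c * q ^ 4)) * (1 - q / (c * q ^ 4) * q ^ 2))) := by
    rw [← mul_div_assoc, eq_div_iff (mul_ne_zero n1 n2)]
    linear_combination (1 - q / (c * q ^ 4)) * e2 +
      (1 - q / (c * q ^ 4) * q ^ 2 * q ^ (2 * k)) * e1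
  rw [quadTerm, quadKernel, e, qint_eq hq, h6]
  ring

theorem quadTerm_shift_eq {q b c : K} (hq0 : q ≠ 0) (hc0 : c ≠ 0) (hq : q ≠ 1)
    (hc : ∀ j, c * q ^ j ≠ 1) (hc' : ∀ j, (q ^ (2 * j)) ^ 2 ≠ c) (k : ℕ) :
    quadTerm q b (c * q ^ 4) k = quadKernel q b c k *
      ((1 - q * (q ^ (2 * k)) ^ 3) / (1 - q) *
        ((1 - q * c * q ^ (2 * k)) * (1 - q * c * q ^ 2 * q ^ (2 * k)) /
          ((1 - q * c) * (1 - q * c * q ^ 2))) *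
        ((1 - q ^ 4 * c) / (1 - q ^ 4 * c * (q ^ (2 * k)) ^ 2)) *
        ((1 - (q ^ (2 * k)) ^ 2 / c) / (1 - 1 / c))) := by
  have h2 : (q ^ 2) ^ k = q ^ (2 * k) := (pow_mul q 2 k).symm
  have h4 : (q ^ 4) ^ k = (q ^ (2 * k)) ^ 2 := by ring
  have h6 : q ^ (6 * k + 1) = q * (q ^ (2 * k)) ^ 3 := by ring
  have m1 : 1 - q * c ≠ 0 := fun h => hc 1 (by linear_combination -h)
  have m2 : 1 - q * c * q ^ 2 ≠ 0 := fun h => hc 3 (by linear_combination -h)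
  have m3 : 1 - q ^ 4 * c ≠ 0 := fun h => hc 4 (by linear_combination -h)
  have m4 : 1 - q ^ 4 * c * (q ^ (2 * k)) ^ 2 ≠ 0 := fun h =>
    hc (4 + 4 * k) (by linear_combination -h)
  have m5 : 1 - 1 / c ≠ 0 := by
    intro h
    apply hc 0
    field_simp at h
    linear_combination h
  have m6 : 1 - (q ^ (2 * k)) ^ 2 / c ≠ 0 := by
    intro h
    apply hc' k
    field_simp at h
    linear_combination -h
  have e : qPoch (q * (c * q ^ 4)) (q ^ 2) k = qPoch (q * c) (q ^ 2) k *
      ((1 - q * c * q ^ (2 * k)) * (1 - q * c * q ^ 2 * q ^ (2 * k)) /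
          ((1 - q * c) * (1 - q * c * q ^ 2))) := by
    have e1 := one_sub_mul_qPoch_mul (q * c) (q ^ 2) k
    have e2 := one_sub_mul_qPoch_mul (q * c * q ^ 2) (q ^ 2) k
    rw [h2] at e1 e2
    rw [show q * c * q ^ 2 * q ^ 2 = q * (c * q ^ 4) by ring] at e2
    rw [← mul_div_assoc, eq_div_iff (mul_ne_zero m1 m2)]
    linear_combination (1 - q * c) * e2 + (1 - q * c * q ^ 2 * q ^ (2 * k)) * e1
  have f : (qPoch (q ^ 4 * (c * q ^ 4)) (q ^ 4) k)⁻¹ = (qPoch (q ^ 4 * c) (q ^ 4) k)⁻¹ *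
      ((1 - q ^ 4 * c) / (1 - q ^ 4 * c * (q ^ (2 * k)) ^ 2)) := by
    have e1 := one_sub_mul_qPoch_mul (q ^ 4 * c) (q ^ 4) k
    rw [h4, mul_assoc (q ^ 4)] at e1
    rw [eq_div_of_mul_eq m3 ((mul_comm _ _).trans e1), inv_div, mul_div_assoc', inv_mul_eq_div,
      div_div]
  have g : (qPoch (q ^ 4 / (c * q ^ 4)) (q ^ 4) k)⁻¹ = (qPoch (q ^ 4 / c) (q ^ 4) k)⁻¹ *
      ((1 - (q ^ (2 * k)) ^ 2 / c) / (1 - 1 / c)) := by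
    have e1 := one_sub_mul_qPoch_mul (1 / c) (q ^ 4) k
    rw [h4, show 1 / c * q ^ 4 = q ^ 4 / c by ring,
      show 1 / c * (q ^ (2 * k)) ^ 2 = (q ^ (2 * k)) ^ 2 / c by ring] at e1
    rw [show q ^ 4 / (c * q ^ 4) = 1 / c by field_simp,
      eq_div_of_mul_eq m6 e1.symm, inv_div, ← div_div, ← mul_div_assoc, inv_mul_eq_div, mul_comm]
    field_simp
  rw [quadTerm, quadKernel, e, qint_eq hq, h6]
  simp only [div_eq_mul_inv _ (_ * qPoch (b * q ^ 2) (q ^ 2) k), mul_inv, f, g]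
  ring

theorem quadTerm_telescope {q b c : K} (hq0 : q ≠ 0) (hb0 : b ≠ 0) (hc0 : c ≠ 0)
    (hq : ∀ j, q ^ (j + 1) ≠ 1) (hc : ∀ j, c * q ^ j ≠ 1)
    (hc' : ∀ j, (q ^ (2 * j)) ^ 2 ≠ c) (hb : ∀ j, b * q ^ j ≠ 1)
    (hbc : b * q ^ 3 * c ≠ 1) (k : ℕ) :
    quadTerm q b (c * q ^ 4) k - quadRatio q b c * quadTerm q b c k =
      quadCert q b c (k + 1) - quadCert q b c k := by
  have hq1 : q ≠ 1 := by simpa using hq 0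
  have m0 : 1 - c ≠ 0 := fun h => hc 0 (by linear_combination -h)
  have m1 : 1 - q * c ≠ 0 := fun h => hc 1 (by linear_combination -h)
  have m3 : 1 - q ^ 3 * c ≠ 0 := fun h => hc 3 (by linear_combination -h)
  have m4 : 1 - q ^ 4 * c * (q ^ (2 * k)) ^ 2 ≠ 0 := fun h =>
    hc (4 + 4 * k) (by linear_combination -h)
  have m5 : c - q ^ 4 * (q ^ (2 * k)) ^ 2 ≠ 0 := fun h =>
    hc' (k + 1) (by linear_combination -h)
  have m6 : 1 - b * q ^ 2 * q ^ (2 * k) ≠ 0 := fun h =>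
    hb (2 + 2 * k) (by linear_combination -h)
  have m7 : 1 - q ^ 4 * (q ^ (2 * k)) ^ 2 ≠ 0 := fun h =>
    hq (3 + 4 * k) (by linear_combination -h)
  have m8 : 1 - b * q ^ 3 * c ≠ 0 := fun h => hbc (by linear_combination -h)
  have m9 : 1 - q ≠ 0 := sub_ne_zero.2 hq1.symm
  rw [quadTerm_eq hq0 hc0 hq1 hc, quadTerm_shift_eq hq0 hc0 hq1 hc hc', quadCert, quadCert,
    quadKernel_succ, quadRatio, show q ^ (2 * (k + 1)) = q ^ 2 * q ^ (2 * k) by ring]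
  clear hq hc hc' hb hbc
  generalize quadKernel q b c k = P
  generalize q ^ (2 * k) = x at *
  have t1 : (1 - q / (c * q ^ 4) * x) * (1 - q / (c * q ^ 4) * q ^ 2 * x) /
      ((1 - q / (c * q ^ 4)) * (1 - q / (c * q ^ 4) * q ^ 2)) =
      (q ^ 3 * c - x) * (q * c - x) / ((1 - q ^ 3 * c) * (1 - q * c)) := by
    rw [show 1 - q / (c * q ^ 4) = -(1 - q ^ 3 * c) / (q ^ 3 * c) by field_simp; ring,
      show 1 - q / (c * q ^ 4) * q ^ 2 = -(1 - q * c) / (q * c) by field_simp; ring]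
    field_simp
  have t2 : (1 - x ^ 2 / c) / (1 - 1 / c) = -(c - x ^ 2) / (1 - c) := by
    rw [show 1 - 1 / c = -(1 - c) / c by field_simp; ring]
    field_simp
  have t3 : (1 - (q ^ 2 * x) ^ 2) * (1 - (q ^ 2 * x) ^ 2 / c) * (1 - b * (q ^ 2 * x)) *
      (P * ((1 - q * x) * (1 - q / (c * q ^ 4) * x) * (1 - q * c * x) * (1 - q / b * x ^ 2) /
        ((1 - q ^ 4 * x ^ 2) * (1 - q ^ 4 * c * x ^ 2) * (1 - q ^ 4 / c * x ^ 2) *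
          (1 - b * q ^ 2 * x)) * (q ^ 2 * x) * b)) =
      P * ((1 - q * x) * (q ^ 3 * c - x) * (1 - q * c * x) * (b - q * x ^ 2) * x /
        (q * c * (1 - q ^ 4 * c * x ^ 2))) := by
    rw [show 1 - q ^ 4 / c * x ^ 2 = (c - q ^ 4 * x ^ 2) / c by field_simp,
      show 1 - (q ^ 2 * x) ^ 2 / c = (c - q ^ 4 * x ^ 2) / c by field_simp,
      show 1 - (q ^ 2 * x) ^ 2 = 1 - q ^ 4 * x ^ 2 by ring,
      show 1 - b * (q ^ 2 * x) = 1 - b * q ^ 2 * x by ring]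
    generalize 1 - b * q ^ 2 * x = d at *
    generalize 1 - q ^ 4 * c * x ^ 2 = d' at *
    field_simp
  rw [mul_div_assoc _ (_ * _) (_ * _), t1, t2, mul_assoc (_ / _) _ (P * _), t3,
    show 1 - q * c * q ^ 2 = 1 - q ^ 3 * c by ring]
  clear t1 t2 t3
  generalize hd : 1 - b * q ^ 3 * c = d at *
  generalize hd' : 1 - q ^ 4 * c * x ^ 2 = d' at *
  field_simp
  subst hd hd'
  ring

theorem sum_quadTerm {q b : K} (hq0 : q ≠ 0) (hb0 : b ≠ 0)
    (hq : Function.Injective fun j : ℕ => q ^ j) (hb : ∀ j, b * q ^ j ≠ 1) {N M : ℕ}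
    (hM : 2 * N ≤ M) :
    ∑ k ∈ Finset.range (M + 1), quadTerm q b (q ^ (4 * N + 1)) k =
      (qPoch (q ^ 5) (q ^ 4) N * qPoch (q ^ 2 / b) (q ^ 4) N /
        (qPoch q (q ^ 4) N * qPoch (b * q ^ 4) (q ^ 4) N)) * (b / q) ^ N := by
  have hq' : ∀ j, q ^ (j + 1) ≠ 1 := fun j h =>
    absurd (hq (h.trans (pow_zero q).symm)) j.succ_ne_zero
  induction N with
  | zero =>
    rw [Finset.sum_eq_single_of_mem 0 (by simp)]
    · simp [quadTerm, qPoch, qint]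
    · intro k _ hk
      have h : qPoch (q / q ^ (4 * 0 + 1)) (q ^ 2) k = 0 :=
        qPoch_eq_zero (i := 0) (Nat.pos_of_ne_zero hk) (by simp [hq0])
      rw [quadTerm, h]
      simp
  | succ N ih =>
    have hc : ∀ j, q ^ (4 * N + 1) * q ^ j ≠ 1 := fun j h =>
      hq' (4 * N + j) (by rw [← h]; ring)
    have hc' : ∀ j, (q ^ (2 * j)) ^ 2 ≠ q ^ (4 * N + 1) := fun j h => by
      have := hq (a₁ := 2 * j * 2) (a₂ := 4 * N + 1) (by simpa only [pow_mul] using h)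
      omega
    have hbc : b * q ^ 3 * q ^ (4 * N + 1) ≠ 1 := fun h =>
      hb (4 * N + 4) (by rw [← h]; ring)
    have hz : quadCert q b (q ^ (4 * N + 1)) (M + 1) = 0 := by
      have h : qPoch (q / (q ^ (4 * N + 1) * q ^ 4)) (q ^ 2) (M + 1) = 0 := by
        refine qPoch_eq_zero (i := 2 * N + 2) (by omega) ?_
        field_simp
        ring
      simp [quadCert, quadKernel, h]
    have hz' : quadCert q b (q ^ (4 * N + 1)) 0 = 0 := by simp [quadCert]
    have ht : ∑ k ∈ Finset.range (M + 1), quadTerm q b (q ^ (4 * N + 1) * q ^ 4) k -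
        quadRatio q b (q ^ (4 * N + 1)) *
          ∑ k ∈ Finset.range (M + 1), quadTerm q b (q ^ (4 * N + 1)) k = 0 := by
      rw [Finset.mul_sum, ← Finset.sum_sub_distrib, Finset.sum_congr rfl fun k _ =>
        quadTerm_telescope hq0 hb0 (pow_ne_zero _ hq0) hq' hc hc' hb hbc k,
        Finset.sum_range_sub, hz, hz', sub_zero]
    rw [show q ^ (4 * (N + 1) + 1) = q ^ (4 * N + 1) * q ^ 4 by ring, sub_eq_zero.1 ht,
      ih (by omega)]
    have hr : quadRatio q b (q ^ (4 * N + 1)) =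
        (1 - q ^ 5 * (q ^ 4) ^ N) * (1 - q ^ 2 / b * (q ^ 4) ^ N) /
          ((1 - q * (q ^ 4) ^ N) * (1 - b * q ^ 4 * (q ^ 4) ^ N)) * (b / q) := by
      have e1 : 1 - q ^ 2 / b * (q ^ 4) ^ N = (b - q ^ 2 * (q ^ 4) ^ N) / b := by field_simp
      have e2 : q ^ (4 * N + 1) = q * (q ^ 4) ^ N := by ring
      rw [quadRatio, e1, e2]
      generalize (q ^ 4) ^ N = y
      rw [show 1 - b * q ^ 3 * (q * y) = 1 - b * q ^ 4 * y by ring]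
      generalize 1 - q * y = d
      generalize 1 - b * q ^ 4 * y = d'
      field_simp
    rw [hr]
    simp only [qPoch_succ, div_eq_mul_inv, mul_inv]
    ring

end QPoch

theorem qv_ne_zero : qv ≠ 0 := by
  simp [qv]

theorem bv_ne_zero : bv ≠ 0 := by
  simp [bv]

theorem qv_pow_injective : Function.Injective fun j : ℕ => qv ^ j := by
  intro i j h
  simp only [qv, ← map_pow] at h
  have h' := congrArg MvPolynomial.totalDegree
    (IsFractionRing.injective (MvPolynomial (Fin 2) ℚ) Qqb h)
  simpa using h'

theorem bv_mul_qv_pow_ne_one (j : ℕ) : bv * qv ^ j ≠ 1 := by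
  intro h
  rw [bv, qv, ← map_pow, ← map_mul,
    ← map_one (algebraMap (MvPolynomial (Fin 2) ℚ) Qqb)] at h
  have h' := congrArg MvPolynomial.constantCoeff
    (IsFractionRing.injective (MvPolynomial (Fin 2) ℚ) Qqb h)
  simp at h'

theorem stmt_14 (n : ℕ) (hn : 0 < n) (h4 : n % 4 = 1) (M : ℕ)
    (hM : M = (n - 1) / 2 ∨ M = n - 1) :
    (∑ k ∈ Finset.range (M + 1),
        qint qv (6 * k + 1) *
          (qPoch qv (qv ^ 2) k * qPoch (qv ^ ((1 : ℤ) - n)) (qv ^ 2) k *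
            qPoch (qv ^ (1 + n)) (qv ^ 2) k) *
          qPoch (qv / bv) (qv ^ 4) k /
          ((qPoch (qv ^ 4) (qv ^ 4) k * qPoch (qv ^ ((4 : ℤ) + n)) (qv ^ 4) k *
              qPoch (qv ^ ((4 : ℤ) - n)) (qv ^ 4) k) *
            qPoch (bv * qv ^ 2) (qv ^ 2) k) *
          qv ^ (k ^ 2 + k) * bv ^ k) =
      (qPoch (qv ^ 5) (qv ^ 4) ((n - 1) / 4) *
          qPoch (qv ^ 2 / bv) (qv ^ 4) ((n - 1) / 4) /
        (qPoch qv (qv ^ 4) ((n - 1) / 4) *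
          qPoch (bv * qv ^ 4) (qv ^ 4) ((n - 1) / 4))) *
        (bv / qv) ^ ((n - 1) / 4) := by
  obtain ⟨N, rfl⟩ : ∃ N, n = 4 * N + 1 := ⟨n / 4, by omega⟩
  rw [show (4 * N + 1 - 1) / 4 = N by omega,
    ← sum_quadTerm qv_ne_zero bv_ne_zero qv_pow_injective bv_mul_qv_pow_ne_one
      (show 2 * N ≤ M by omega)]
  refine Finset.sum_congr rfl fun k _ => ?_
  have e1 : qv ^ ((1 : ℤ) - (4 * N + 1 : ℕ)) = qv / qv ^ (4 * N + 1) := by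
    rw [zpow_sub₀ qv_ne_zero, zpow_one, zpow_natCast]
  have e2 : qv ^ (1 + (4 * N + 1)) = qv * qv ^ (4 * N + 1) := by
    rw [pow_add, pow_one]
  have e3 : qv ^ ((4 : ℤ) + (4 * N + 1 : ℕ)) = qv ^ 4 * qv ^ (4 * N + 1) := by
    rw [zpow_add₀ qv_ne_zero, zpow_natCast, zpow_ofNat]
  have e4 : qv ^ ((4 : ℤ) - (4 * N + 1 : ℕ)) = qv ^ 4 / qv ^ (4 * N + 1) := by
    rw [zpow_sub₀ qv_ne_zero, zpow_natCast, zpow_ofNat]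
  rw [quadTerm, e1, e2, e3, e4]
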